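/- arXiv:2409.04879 — 3 statements merged into one kernel-verified Lean document; each statement's English description precedes it below -/
import Mathlib

section
/- Let c = s_{i_1}s_{i_2}⋯s_{i_r} be a Coxeter-type element of W, i.e., s_{i_1}, …, s_{i_r} are pairwise distinct simple reflections. Then the map sending a subset E ⊆ {1, …, r} to the product of the reflections s_{i_j} with j ∈ E, taken in increasing order of j, is an order isomorphism from the Boolean lattice of subsets of {1, …, r} ordered by inclusion onto the Bruhat interval [e, c]. In particular, ℓ(c) = r and [e, c] has exactly 2^r elements. -/
/-!
Statement 3. Let `c = s_{i_1} ⋯ s_{i_r}` be a Coxeter-type element (the `s_{i_j}` are pairwise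
distinct simple reflections). Then `E ↦ ∏_{j ∈ E, increasing} s_{i_j}` is an order isomorphism
from the Boolean lattice of subsets of `{1, …, r}` onto the Bruhat interval `[e, c]`.
In particular `ℓ(c) = r` and `[e, c]` has exactly `2^r` elements.
-/

variable {B W : Type*} [Group W] {M : CoxeterMatrix B}

/-- The Bruhat order on a Coxeter group, via the subword property. -/
def CoxeterSystem.bruhatLE (cs : CoxeterSystem M W) (u w : W) : Prop :=
  ∃ ω : List B, cs.IsReduced ω ∧ cs.wordProd ω = w ∧
    ∃ l : List B, l.Sublist ω ∧ cs.wordProd l = u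

/-- The product of the letters of `l` at the positions in `E`, taken in increasing order of
position. -/
def CoxeterSystem.subsetProd (cs : CoxeterSystem M W) (l : List B)
    (E : Finset (Fin l.length)) : W :=
  cs.wordProd (((List.finRange l.length).filter (· ∈ E)).map l.get)

open Polynomial.Chebyshev in
/-- For `t = 2 cos (2 π / m)` with `m ≥ 3`, the Chebyshev coefficients in the formula for the
`m`-th power of a product of two reflections vanish. -/
lemma chebyshev_S_coeffs_eq_zero {m : ℕ} (hm : 3 ≤ m) {t : ℝ}
    (ht : t = 2 * Real.cos (2 * (Real.pi / m))) :
    (S ℝ (((m : ℤ) - 2) / 2)).eval t *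
        ((S ℝ (((m : ℤ) - 1) / 2)).eval t + (S ℝ (((m : ℤ) - 3) / 2)).eval t) = 0 ∧
      (S ℝ (((m : ℤ) - 1) / 2)).eval t *
        ((S ℝ ((m : ℤ) / 2)).eval t + (S ℝ (((m : ℤ) - 2) / 2)).eval t) = 0 := by
  have hm' : (3 : ℝ) ≤ m := by exact_mod_cast hm
  have hm0 : (m : ℝ) ≠ 0 := by positivity
  have hpi := Real.pi_pos
  have hsin : Real.sin (2 * (Real.pi / m)) ≠ 0 := by
    apply ne_of_gt
    apply Real.sin_pos_of_pos_of_lt_pi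
    · positivity
    · rw [← mul_div_assoc, div_lt_iff₀ (by positivity)]
      nlinarith
  have key (n : ℤ) : (S ℝ n).eval t =
      Real.sin ((n + 1) * (2 * (Real.pi / m))) / Real.sin (2 * (Real.pi / m)) := by
    rw [eq_div_iff hsin, ht, S_two_mul_real_cos]
  rcases Nat.even_or_odd' m with ⟨p, hp | hp⟩
  · have h1 : ((m : ℤ) - 2) / 2 = p - 1 := by lia
    have h2 : ((m : ℤ) - 1) / 2 = p - 1 := by lia
    have hz : (S ℝ ((p : ℤ) - 1)).eval t = 0 := by
      rw [key, div_eq_zero_iff]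
      left
      have : (((p : ℤ) - 1 : ℤ) + 1 : ℝ) * (2 * (Real.pi / m)) = Real.pi := by
        have : (m : ℝ) = 2 * p := by exact_mod_cast hp
        push_cast
        field_simp
        linarith
      rw [this, Real.sin_pi]
    rw [h1, h2, hz]
    simp
  · have h1 : ((m : ℤ) - 2) / 2 = p - 1 := by lia
    have h2 : ((m : ℤ) - 1) / 2 = p := by lia
    have h3 : ((m : ℤ) - 3) / 2 = p - 1 := by lia
    have h4 : (m : ℤ) / 2 = p := by lia
    have hz : (S ℝ (p : ℤ)).eval t + (S ℝ ((p : ℤ) - 1)).eval t = 0 := by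
      rw [key, key, ← add_div, div_eq_zero_iff]
      left
      have : (((p : ℤ) : ℝ) + 1) * (2 * (Real.pi / m)) =
          2 * Real.pi - (((p : ℤ) - 1 : ℤ) + 1 : ℝ) * (2 * (Real.pi / m)) := by
        have : (m : ℝ) = 2 * p + 1 := by exact_mod_cast hp
        push_cast
        field_simp
        linarith
      rw [this, Real.sin_two_pi_sub]
      ring
    rw [h1, h2, h3, h4, hz]
    simp

namespace CoxeterMatrix

/-- The (symmetric) Cartan matrix `-2 cos (π / M i j)`; its value is `-2` where `M i j = 0`. -/
noncomputable def cartan (M : CoxeterMatrix B) (i j : B) : ℝ :=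
  -2 * Real.cos (Real.pi / M i j)

lemma cartan_self (M : CoxeterMatrix B) (i : B) : M.cartan i i = 2 := by
  simp [cartan]

lemma cartan_comm (M : CoxeterMatrix B) (i j : B) : M.cartan i j = M.cartan j i := by
  rw [cartan, M.symmetric, cartan]

lemma cartan_eq_zero_of_eq_two (M : CoxeterMatrix B) {i j : B} (h : M i j = 2) :
    M.cartan i j = 0 := by
  simp [cartan, h]

lemma cartan_neg (M : CoxeterMatrix B) {i j : B} (hij : i ≠ j) (h : M i j ≠ 2) :
    M.cartan i j < 0 := by
  have h1 := M.off_diagonal i j hij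
  have hcos : 0 < Real.cos (Real.pi / M i j) := by
    rcases Nat.eq_zero_or_pos (M i j) with h0 | h0
    · simp [h0]
    · have h3 : (3 : ℝ) ≤ M i j := by exact_mod_cast (by lia : 3 ≤ M i j)
      have hpi := Real.pi_pos
      apply Real.cos_pos_of_mem_Ioo
      constructor
      · have : 0 < Real.pi / M i j := by positivity
        linarith
      · rw [div_lt_div_iff₀ (by positivity) (by positivity)]
        nlinarith
  rw [cartan]
  linarith

lemma cartan_nonpos (M : CoxeterMatrix B) {i j : B} (hij : i ≠ j) : M.cartan i j ≤ 0 := by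
  by_cases h : M i j = 2
  · exact (M.cartan_eq_zero_of_eq_two h).le
  · exact (M.cartan_neg hij h).le

/-- The simple coroot: the linear form sending the `j`-th basis vector to `M.cartan i j`. -/
noncomputable def coroot (M : CoxeterMatrix B) (i : B) : Module.Dual ℝ (B →₀ ℝ) :=
  Finsupp.linearCombination ℝ (M.cartan i)

lemma coroot_single (M : CoxeterMatrix B) (i j : B) :
    M.coroot i (Finsupp.single j 1) = M.cartan i j := by
  simp [coroot]

lemma coroot_single_self (M : CoxeterMatrix B) (i : B) :
    M.coroot i (Finsupp.single i 1) = 2 := by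
  rw [coroot_single, cartan_self]

/-- The simple reflection of the geometric representation. -/
noncomputable def simpleReflection (M : CoxeterMatrix B) (i : B) : (B →₀ ℝ) ≃ₗ[ℝ] (B →₀ ℝ) :=
  Module.reflection (M.coroot_single_self i)

lemma simpleReflection_apply (M : CoxeterMatrix B) (i : B) (v : B →₀ ℝ) :
    M.simpleReflection i v = v - M.coroot i v • Finsupp.single i 1 :=
  Module.reflection_apply _ _

lemma isLiftable_simpleReflection (M : CoxeterMatrix B) :
    M.IsLiftable M.simpleReflection := by
  intro i j
  rcases eq_or_ne i j with rfl | hij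
  · rw [M.diagonal, pow_one]
    ext1 v
    exact Module.involutive_reflection (M.coroot_single_self i) v
  refine LinearEquiv.ext fun v ↦ ?_
  rw [simpleReflection, simpleReflection,
    Module.reflection_mul_reflection_pow_apply _ _ _ _ _ rfl, LinearEquiv.coe_one, id_eq]
  have h1 := M.off_diagonal i j hij
  rcases (by lia : M i j = 0 ∨ M i j = 2 ∨ 3 ≤ M i j) with h | h | h
  · simp [h]
  · have e1 : M.coroot i (Finsupp.single j 1) = 0 := by
      rw [coroot_single, cartan_eq_zero_of_eq_two M h]
    have e2 : M.coroot j (Finsupp.single i 1) = 0 := by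
      rw [coroot_single, cartan_comm, cartan_eq_zero_of_eq_two M h]
    rw [h, e1, e2]
    simp
    module
  · obtain ⟨h1, h2⟩ := chebyshev_S_coeffs_eq_zero h
      (t := M.coroot i (Finsupp.single j 1) * M.coroot j (Finsupp.single i 1) - 2) (by
        rw [coroot_single, coroot_single, M.cartan_comm j i, cartan, Real.cos_two_mul]
        ring)
    rw [h1, h2]
    simp

end CoxeterMatrix

namespace CoxeterSystem

/-- The geometric representation of a Coxeter group. -/
noncomputable def geometricRep (cs : CoxeterSystem M W) : W →* ((B →₀ ℝ) ≃ₗ[ℝ] (B →₀ ℝ)) :=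
  cs.lift ⟨M.simpleReflection, M.isLiftable_simpleReflection⟩

lemma geometricRep_simple_apply (cs : CoxeterSystem M W) (i : B) (v : B →₀ ℝ) :
    cs.geometricRep (cs.simple i) v = v - M.coroot i v • Finsupp.single i 1 := by
  rw [geometricRep, lift_apply_simple, M.simpleReflection_apply]

/-- The subgroup of elements which preserve the `i`-th coordinate in the geometric
representation. It contains all the simple reflections other than the `i`-th. -/
def coordFixer (cs : CoxeterSystem M W) (i : B) : Subgroup W where
  carrier := {w | ∀ v, cs.geometricRep w v i = v i}
  one_mem' := by simp
  mul_mem' {a b} ha hb v := by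
    rw [map_mul, LinearEquiv.mul_apply, ha, hb]
  inv_mem' {a} ha v := by
    rw [← ha, ← LinearEquiv.mul_apply, ← map_mul, mul_inv_cancel, map_one, LinearEquiv.coe_one, id_eq]

lemma mem_coordFixer (cs : CoxeterSystem M W) {i : B} {w : W} :
    w ∈ cs.coordFixer i ↔ ∀ v, cs.geometricRep w v i = v i :=
  Iff.rfl

lemma simple_mem_coordFixer (cs : CoxeterSystem M W) {i j : B} (hij : i ≠ j) :
    cs.simple j ∈ cs.coordFixer i := by
  intro v
  simp [geometricRep_simple_apply, hij]

lemma simple_notMem_coordFixer (cs : CoxeterSystem M W) (i : B) :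
    cs.simple i ∉ cs.coordFixer i := by
  intro h
  have := h (Finsupp.single i 1)
  rw [geometricRep_simple_apply, M.coroot_single_self] at this
  norm_num at this

lemma wordProd_mem_coordFixer (cs : CoxeterSystem M W) {i : B} {ω : List B} (h : i ∉ ω) :
    cs.wordProd ω ∈ cs.coordFixer i := by
  induction ω with
  | nil => simp [one_mem]
  | cons j ω ih =>
    rw [List.mem_cons, not_or] at h
    rw [wordProd_cons]
    exact mul_mem (cs.simple_mem_coordFixer h.1) (ih h.2)

lemma wordProd_notMem_coordFixer (cs : CoxeterSystem M W) {i : B} {l : List B} (hl : l.Nodup)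
    (h : i ∈ l) : cs.wordProd l ∉ cs.coordFixer i := by
  obtain ⟨a, b, rfl⟩ := List.append_of_mem h
  have hi := (List.nodup_middle.mp hl).notMem
  rw [List.mem_append, not_or] at hi
  rw [wordProd_append, wordProd_cons,
    Subgroup.mul_mem_cancel_left _ (cs.wordProd_mem_coordFixer hi.1),
    Subgroup.mul_mem_cancel_right _ (cs.wordProd_mem_coordFixer hi.2)]
  exact cs.simple_notMem_coordFixer i

/-- Every letter of a duplicate-free word occurs in every word with the same product. -/
lemma subset_of_nodup_of_wordProd_eq (cs : CoxeterSystem M W) {l ω : List B} (hl : l.Nodup)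
    (h : cs.wordProd l = cs.wordProd ω) : l ⊆ ω := by
  intro i hi
  by_contra hω
  exact cs.wordProd_notMem_coordFixer hl hi (h ▸ cs.wordProd_mem_coordFixer hω)

lemma isReduced_of_nodup (cs : CoxeterSystem M W) {l : List B} (hl : l.Nodup) :
    cs.IsReduced l := by
  obtain ⟨ω, hω, h⟩ := cs.exists_isReduced (cs.wordProd l)
  have hle := (List.subperm_of_subset hl (cs.subset_of_nodup_of_wordProd_eq hl h)).length_le
  apply le_antisymm (cs.length_wordProd_le l)
  rwa [h, hω.eq]

lemma perm_of_nodup_of_isReduced (cs : CoxeterSystem M W) {l ω : List B} (hl : l.Nodup)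
    (hω : cs.IsReduced ω) (h : cs.wordProd l = cs.wordProd ω) : l.Perm ω := by
  apply (List.subperm_of_subset hl (cs.subset_of_nodup_of_wordProd_eq hl h)).perm_of_length_le
  rw [← hω.eq, ← h]
  exact cs.length_wordProd_le l

lemma coroot_geometricRep_wordProd_le (cs : CoxeterSystem M W) (i : B) {a : List B}
    (ha : a.Nodup) (hi : i ∉ a) {j : B} (hj : j ∉ a) :
    M.coroot j (cs.geometricRep (cs.wordProd a) (Finsupp.single i 1)) ≤ M.cartan j i := by
  induction a generalizing j with
  | nil => simp [M.coroot_single]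
  | cons k a ih =>
    rw [List.nodup_cons] at ha
    rw [List.mem_cons, not_or] at hi hj
    rw [wordProd_cons, map_mul, LinearEquiv.mul_apply, geometricRep_simple_apply, map_sub,
      map_smul, M.coroot_single, smul_eq_mul]
    have h1 := ih ha.2 hi.2 hj.2
    have h2 := ih ha.2 hi.2 ha.1
    have h3 := M.cartan_nonpos (Ne.symm hi.1)
    have h4 := M.cartan_nonpos hj.1
    nlinarith [mul_nonneg_of_nonpos_of_nonpos (h2.trans h3) h4]

lemma eq_two_of_two_le_coroot (cs : CoxeterSystem M W) (i : B) {a : List B}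
    (ha : a.Nodup) (hi : i ∉ a)
    (h : 2 ≤ M.coroot i (cs.geometricRep (cs.wordProd a) (Finsupp.single i 1))) :
    ∀ j ∈ a, M i j = 2 := by
  induction a with
  | nil => simp
  | cons k a ih =>
    rw [List.nodup_cons] at ha
    rw [List.mem_cons, not_or] at hi
    rw [wordProd_cons, map_mul, LinearEquiv.mul_apply, geometricRep_simple_apply, map_sub,
      map_smul, M.coroot_single, smul_eq_mul] at h
    have h1 := cs.coroot_geometricRep_wordProd_le i ha.2 hi.2 hi.2
    rw [M.cartan_self] at h1
    have h2 := cs.coroot_geometricRep_wordProd_le i ha.2 hi.2 ha.1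
    have h3 := M.cartan_nonpos hi.1
    rw [M.cartan_comm] at h2
    have h4 := mul_nonneg_of_nonpos_of_nonpos (h2.trans h3) h3
    rw [List.forall_mem_cons]
    refine ⟨?_, ih ha.2 hi.2 (by linarith)⟩
    by_contra hne
    have h5 := M.cartan_neg hi.1 hne
    have h6 := mul_pos_of_neg_of_neg (h2.trans_lt h5) h5
    linarith

lemma commute_simple_of_eq_two (cs : CoxeterSystem M W) {i j : B} (h : M i j = 2) :
    Commute (cs.simple i) (cs.simple j) := by
  have hp := cs.simple_mul_simple_pow i j
  rw [h, pow_two, mul_eq_one_iff_eq_inv, mul_inv_rev, inv_simple, inv_simple] at hp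
  exact hp

/-- If conjugating a duplicate-free word without the letter `i` by the `i`-th simple reflection
gives an element preserving the `i`-th coordinate, then that reflection commutes with every
letter of the word. -/
lemma commute_simple_of_conj_mem_coordFixer (cs : CoxeterSystem M W) {i : B} {a : List B}
    (ha : a.Nodup) (hi : i ∉ a)
    (h : cs.simple i * cs.wordProd a * cs.simple i ∈ cs.coordFixer i) :
    ∀ j ∈ a, Commute (cs.simple i) (cs.simple j) := by
  have hv := h (cs.geometricRep (cs.simple i) (Finsupp.single i 1))
  rw [← LinearEquiv.mul_apply, ← map_mul, mul_assoc, simple_mul_simple_self, mul_one, map_mul,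
    LinearEquiv.mul_apply, geometricRep_simple_apply, geometricRep_simple_apply,
    M.coroot_single_self, Finsupp.sub_apply, cs.wordProd_mem_coordFixer hi] at hv
  simp at hv
  exact fun j hj ↦ cs.commute_simple_of_eq_two
    (cs.eq_two_of_two_le_coroot i ha hi (by linarith) j hj)

lemma commute_simple_wordProd (cs : CoxeterSystem M W) {i : B} {a : List B}
    (h : ∀ j ∈ a, Commute (cs.simple i) (cs.simple j)) :
    Commute (cs.simple i) (cs.wordProd a) := by
  rw [wordProd]
  apply Commute.list_prod_right
  simpa using h

/-- Two duplicate-free rearrangements of the same letters with the same product also have the same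
product after restricting to any subset of the letters. -/
lemma wordProd_filter_eq_of_perm (cs : CoxeterSystem M W) {l ω : List B} (hl : l.Nodup)
    (hperm : l.Perm ω) (h : cs.wordProd l = cs.wordProd ω) (p : B → Bool) :
    cs.wordProd (l.filter p) = cs.wordProd (ω.filter p) := by
  induction l generalizing ω with
  | nil => rw [hperm.nil_eq]
  | cons i l ih =>
    obtain ⟨a, b, rfl⟩ := List.append_of_mem (hperm.subset List.mem_cons_self)
    have hω := List.nodup_middle.mp (hperm.nodup_iff.mp hl)
    have hi := hω.notMem
    rw [List.mem_append, not_or] at hi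
    have ha : a.Nodup := hω.of_cons.of_append_left
    rw [wordProd_cons, wordProd_append, wordProd_cons] at h
    have hconj : cs.simple i * cs.wordProd a * cs.simple i =
        cs.wordProd l * (cs.wordProd b)⁻¹ := by
      rw [eq_mul_inv_iff_mul_eq, ← cs.simple_mul_simple_cancel_left (w := cs.wordProd l) i, h]
      simp only [mul_assoc]
    have hcomm := cs.commute_simple_of_conj_mem_coordFixer ha hi.1 (hconj ▸
      mul_mem (cs.wordProd_mem_coordFixer hl.notMem)
        (inv_mem (cs.wordProd_mem_coordFixer hi.2)))
    have hlab : cs.wordProd l = cs.wordProd (a ++ b) := by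
      rw [← mul_assoc, ← (cs.commute_simple_wordProd hcomm).eq, mul_assoc] at h
      rw [wordProd_append]
      exact mul_left_cancel h
    have ih' := ih hl.of_cons ((hperm.trans List.perm_middle).cons_inv) hlab
    rw [List.filter_append, wordProd_append] at ih' ⊢
    have hcomm' := cs.commute_simple_wordProd (a := a.filter p)
      fun j hj ↦ hcomm j (List.mem_of_mem_filter hj)
    by_cases hp : p i
    · rw [List.filter_cons_of_pos hp, List.filter_cons_of_pos hp, wordProd_cons, wordProd_cons,
        ih', ← mul_assoc, ← mul_assoc, hcomm'.eq]
    · rw [List.filter_cons_of_neg hp, List.filter_cons_of_neg hp, ih']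

end CoxeterSystem

lemma List.Nodup.exists_filter_eq_of_sublist {α : Type*} {m l : List α} (hl : l.Nodup)
    (h : m.Sublist l) : ∃ p : α → Bool, l.filter p = m := by
  classical
  refine ⟨fun x ↦ decide (x ∈ m), ?_⟩
  have hsub : m.Sublist (l.filter fun x ↦ decide (x ∈ m)) := by
    have := h.filter fun x ↦ decide (x ∈ m)
    rwa [List.filter_eq_self.mpr (by simp)] at this
  refine (hsub.eq_of_length_le ?_).symm
  exact (List.subperm_of_subset (hl.filter _) (by intro x; simp)).length_le

namespace CoxeterSystem

lemma bruhatLE_wordProd_iff_of_nodup (cs : CoxeterSystem M W) {l : List B} (hl : l.Nodup)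
    {z : W} : cs.bruhatLE z (cs.wordProd l) ↔ ∃ m : List B, m.Sublist l ∧ cs.wordProd m = z := by
  constructor
  · rintro ⟨ω, hω, hprod, m, hm, rfl⟩
    have hperm := cs.perm_of_nodup_of_isReduced hl hω hprod.symm
    obtain ⟨p, rfl⟩ := (hperm.nodup_iff.mp hl).exists_filter_eq_of_sublist hm
    exact ⟨l.filter p, List.filter_sublist, cs.wordProd_filter_eq_of_perm hl hperm hprod.symm p⟩
  · rintro ⟨m, hm, hz⟩
    exact ⟨l, cs.isReduced_of_nodup hl, rfl, m, hm, hz⟩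

end CoxeterSystem

/-- The letters of `l` at the positions in `E`, in increasing order of position. -/
def List.restrict {α : Type*} (l : List α) (E : Finset (Fin l.length)) : List α :=
  ((List.finRange l.length).filter (· ∈ E)).map l.get

lemma List.mem_restrict {α : Type*} {l : List α} {E : Finset (Fin l.length)} {x : α} :
    x ∈ l.restrict E ↔ ∃ k ∈ E, l.get k = x := by
  simp [List.restrict]

lemma List.restrict_sublist {α : Type*} (l : List α) (E : Finset (Fin l.length)) :
    (l.restrict E).Sublist l := by
  have h : (l.restrict E).Sublist ((List.finRange l.length).map l.get) :=
    List.filter_sublist.map _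
  rwa [← List.ofFn_eq_map, List.ofFn_get] at h

lemma List.restrict_sublist_restrict {α : Type*} {l : List α} {E E' : Finset (Fin l.length)}
    (h : E ⊆ E') : (l.restrict E).Sublist (l.restrict E') := by
  apply List.Sublist.map
  apply List.monotone_filter_right
  intro k hk
  simpa using h (by simpa using hk)

lemma List.Nodup.subset_of_restrict_subset {α : Type*} {l : List α} (hl : l.Nodup)
    {E E' : Finset (Fin l.length)} (h : l.restrict E ⊆ l.restrict E') : E ⊆ E' := by
  intro k hk
  obtain ⟨k', hk', hget⟩ := List.mem_restrict.mp (h (List.mem_restrict.mpr ⟨k, hk, rfl⟩))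
  rwa [← List.nodup_iff_injective_get.mp hl hget]

lemma List.Nodup.exists_restrict_eq {α : Type*} {m l : List α} (hl : l.Nodup)
    (h : m.Sublist l) : ∃ E : Finset (Fin l.length), l.restrict E = m := by
  obtain ⟨p, rfl⟩ := hl.exists_filter_eq_of_sublist h
  refine ⟨Finset.univ.filter fun k ↦ p (l.get k), ?_⟩
  conv_rhs => rw [← List.ofFn_get l, List.ofFn_eq_map, List.filter_map]
  simp [List.restrict, Function.comp_def]

theorem boolean_lattice_iso_bruhat_interval_of_coxeter_type
    (cs : CoxeterSystem M W) (l : List B) (hl : l.Nodup) (c : W)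
    (hc : cs.wordProd l = c) :
    (∀ E E' : Finset (Fin l.length),
      E ⊆ E' ↔ cs.bruhatLE (cs.subsetProd l E) (cs.subsetProd l E')) ∧
    (∀ z : W, cs.bruhatLE z c ↔ ∃ E : Finset (Fin l.length), cs.subsetProd l E = z) ∧
    cs.length c = l.length ∧
    Nat.card {z : W // cs.bruhatLE z c} = 2 ^ l.length := by
  subst hc
  have hE (E : Finset (Fin l.length)) : (l.restrict E).Nodup := hl.sublist (l.restrict_sublist E)
  have hprod (E : Finset (Fin l.length)) : cs.subsetProd l E = cs.wordProd (l.restrict E) := rfl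
  have hinterval (z : W) : cs.bruhatLE z (cs.wordProd l) ↔
      ∃ E : Finset (Fin l.length), cs.subsetProd l E = z := by
    rw [cs.bruhatLE_wordProd_iff_of_nodup hl]
    constructor
    · rintro ⟨m, hm, rfl⟩
      obtain ⟨E, rfl⟩ := hl.exists_restrict_eq hm
      exact ⟨E, rfl⟩
    · rintro ⟨E, rfl⟩
      exact ⟨_, l.restrict_sublist E, rfl⟩
  refine ⟨fun E E' ↦ ?_, hinterval, (cs.isReduced_of_nodup hl).eq, ?_⟩
  · rw [hprod, hprod, cs.bruhatLE_wordProd_iff_of_nodup (hE E')]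
    constructor
    · exact fun h ↦ ⟨_, List.restrict_sublist_restrict h, rfl⟩
    · rintro ⟨m, hm, h⟩
      exact hl.subset_of_restrict_subset
        (List.Subset.trans (cs.subset_of_nodup_of_wordProd_eq (hE E) h.symm) hm.subset)
  · have hinj : Function.Injective (cs.subsetProd l) := fun E E' h ↦
      (hl.subset_of_restrict_subset (cs.subset_of_nodup_of_wordProd_eq (hE E) h)).antisymm
        (hl.subset_of_restrict_subset (cs.subset_of_nodup_of_wordProd_eq (hE E') h.symm))
    have hcard : Nat.card {z : W // cs.bruhatLE z (cs.wordProd l)} =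
        Nat.card (Set.range (cs.subsetProd l)) :=
      Nat.card_congr (Equiv.subtypeEquivRight hinterval)
    rw [hcard, Nat.card_range_of_injective hinj]
    simp
end

section
/- Let J ⊆ S be such that W_J is finite, and let c ∈ W be a Coxeter-type element of length r with supp(c) ∩ J = ∅. Set w = w_{0,J}·c and assume ℓ(w) = ℓ(w_{0,J}) + r. Then the Bruhat interval [w_{0,J}, w] is order-isomorphic to the Bruhat interval [e, c], and hence to the Boolean lattice of subsets of an r-element set ordered by inclusion. -/
/-!
Statement 4. Let `J ⊆ S` with `W_J` finite and `c` a Coxeter-type element of length `r` with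
`supp(c) ∩ J = ∅`. Set `w = w_{0,J} * c` and assume `ℓ(w) = ℓ(w_{0,J}) + r`. Then the Bruhat
interval `[w_{0,J}, w]` is order-isomorphic to `[e, c]`, hence to the Boolean lattice of
subsets of an `r`-element set.
-/

variable {B W : Type*} [Group W] {M : CoxeterMatrix B}

/-- The support of `w`. -/
def CoxeterSystem.support (cs : CoxeterSystem M W) (w : W) : Set B :=
  {i : B | ∃ ω : List B, cs.IsReduced ω ∧ cs.wordProd ω = w ∧ i ∈ ω}

/-- The standard parabolic subgroup `W_J`. -/
def CoxeterSystem.parabolic (cs : CoxeterSystem M W) (J : Set B) : Subgroup W :=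
  Subgroup.closure (cs.simple '' J)

namespace CoxeterMatrix

/-- The simple coroot of the geometric representation attached to `i`. -/
noncomputable def geometricCoroot (M : CoxeterMatrix B) (i : B) : Module.Dual ℝ (B →₀ ℝ) :=
  Finsupp.linearCombination ℝ fun j => -2 * Real.cos (Real.pi / M i j)

theorem geometricCoroot_single (M : CoxeterMatrix B) (i j : B) :
    M.geometricCoroot i (Finsupp.single j 1) = -2 * Real.cos (Real.pi / M i j) := by
  simp [geometricCoroot]

theorem geometricCoroot_single_self (M : CoxeterMatrix B) (i : B) :
    M.geometricCoroot i (Finsupp.single i 1) = 2 := by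
  simp [geometricCoroot_single]

/-- The reflection by which the simple generator `i` acts in the geometric representation. -/
noncomputable def geometricReflection (M : CoxeterMatrix B) (i : B) :
    (B →₀ ℝ) ≃ₗ[ℝ] (B →₀ ℝ) :=
  Module.reflection (M.geometricCoroot_single_self i)

open Polynomial.Chebyshev in
theorem isLiftable_geometricReflection (M : CoxeterMatrix B) :
    M.IsLiftable M.geometricReflection := by
  intro i j
  by_cases hij : i = j
  · subst hij
    ext1 z
    simp [geometricReflection, Module.involutive_reflection _ z]
  have h1 : M i j ≠ 1 := M.off_diagonal i j hij
  have hsymm : M j i = M i j := M.symmetric j i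
  ext1 z
  rw [geometricReflection, geometricReflection, Module.reflection_mul_reflection_pow_apply]
  simp only [geometricCoroot_single, hsymm]
  generalize M.geometricCoroot i z = a
  generalize M.geometricCoroot j z = b
  generalize M i j = m at h1
  set t : ℝ := -2 * Real.cos (Real.pi / m) * (-2 * Real.cos (Real.pi / m)) - 2 with ht
  have ht' : t = 2 * Real.cos (2 * Real.pi / m) := by
    rw [ht, mul_div_assoc, Real.cos_two_mul]; ring
  obtain rfl | rfl | hm : m = 0 ∨ m = 2 ∨ 3 ≤ m := by omega
  · simp
  · have : t = -2 := by rw [ht]; simp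
    simp only [this]
    norm_num
    module
  have hm0 : (3 : ℝ) ≤ m := by exact_mod_cast hm
  have hsin : Real.sin (2 * Real.pi / m) ≠ 0 := by
    apply ne_of_gt
    apply Real.sin_pos_of_pos_of_lt_pi
    · positivity
    · rw [div_lt_iff₀ (by positivity)]
      nlinarith [Real.pi_pos]
  have hS (n : ℤ) : (S ℝ n).eval t * Real.sin (2 * Real.pi / m) =
      Real.sin ((n + 1) * (2 * Real.pi / m)) := by
    rw [ht', S_two_mul_real_cos]
  obtain ⟨k, rfl | rfl⟩ := Nat.even_or_odd' m
  · have e1 : (((2 * k : ℕ) : ℤ) - 2) / 2 = k - 1 := by omega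
    have e2 : (((2 * k : ℕ) : ℤ) - 1) / 2 = k - 1 := by omega
    have h0 : (S ℝ ((k : ℤ) - 1)).eval t = 0 := by
      have := hS (k - 1)
      have hk : (k : ℝ) ≠ 0 := by
        have : k ≠ 0 := by omega
        exact_mod_cast this
      have e : ((((k : ℤ) - 1 : ℤ) : ℝ) + 1) * (2 * Real.pi / (2 * k : ℕ)) = Real.pi := by
        push_cast; field_simp; ring
      rw [e, Real.sin_pi] at this
      exact (mul_eq_zero.mp this).resolve_right hsin
    rw [e1, e2, h0]
    simp
  · have e1 : (((2 * k + 1 : ℕ) : ℤ) - 3) / 2 = k - 1 := by omega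
    have e2 : (((2 * k + 1 : ℕ) : ℤ) - 1) / 2 = k := by omega
    have e3 : (((2 * k + 1 : ℕ) : ℤ) - 2) / 2 = k - 1 := by omega
    have e4 : (((2 * k + 1 : ℕ) : ℤ)) / 2 = k := by omega
    have h0 : (S ℝ (k : ℤ)).eval t + (S ℝ ((k : ℤ) - 1)).eval t = 0 := by
      have hk := hS k
      have hk' := hS (k - 1)
      have e : (((k : ℤ) : ℝ) + 1) * (2 * Real.pi / (2 * k + 1 : ℕ)) =
          2 * Real.pi - ((((k : ℤ) - 1 : ℤ) : ℝ) + 1) * (2 * Real.pi / (2 * k + 1 : ℕ)) := by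
        push_cast; field_simp; ring
      rw [e, Real.sin_two_pi_sub, ← hk', ← neg_mul] at hk
      have := mul_right_cancel₀ hsin hk
      rw [this]; ring
    rw [e1, e2, e3, e4, h0]
    simp

end CoxeterMatrix

namespace CoxeterSystem

open List

variable (cs : CoxeterSystem M W)

theorem simple_injective : Function.Injective cs.simple := by
  intro i j h
  by_contra hij
  have hσ : M.geometricReflection i = M.geometricReflection j := by
    rw [← cs.lift_apply_simple M.isLiftable_geometricReflection i, h, cs.lift_apply_simple]
  have := DFunLike.congr_fun (LinearEquiv.congr_fun hσ (Finsupp.single i 1)) i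
  rw [CoxeterMatrix.geometricReflection, CoxeterMatrix.geometricReflection,
    Module.reflection_apply_self, Module.reflection_apply] at this
  simp [Ne.symm hij] at this
  norm_num at this

open Classical in
/-- The involution of `W × ZMod 2` attached to `i`, conjugating the first component by the simple
reflection and flipping the sign exactly when the first component is that reflection. -/
noncomputable def signedConj (i : B) : Equiv.Perm (W × ZMod 2) :=
  Function.Involutive.toPerm
    (fun p => (cs.simple i * p.1 * cs.simple i, p.2 + if p.1 = cs.simple i then 1 else 0)) <| by
    rintro ⟨t, ε⟩
    have h : cs.simple i * t * cs.simple i = cs.simple i ↔ t = cs.simple i := by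
      rw [mul_eq_right, mul_eq_one_iff_eq_inv', inv_simple]
    have h2 : (1 + 1 : ZMod 2) = 0 := rfl
    simp only [h, Prod.mk.injEq]
    refine ⟨by simp [mul_assoc], ?_⟩
    split_ifs <;> simp [add_assoc, h2]

open Classical in
theorem signedConj_apply (i : B) (t : W) (ε : ZMod 2) :
    cs.signedConj i (t, ε) =
      (cs.simple i * t * cs.simple i, ε + if t = cs.simple i then 1 else 0) := rfl

open Classical in
theorem signedConj_mul_pow_apply (i j : B) (n : ℕ) (t : W) (ε : ZMod 2) :
    ((cs.signedConj i * cs.signedConj j) ^ n) (t, ε) =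
      ((cs.simple i * cs.simple j) ^ n * t * ((cs.simple i * cs.simple j) ^ n)⁻¹,
        ε + ∑ k ∈ Finset.range (2 * n),
          if t = ((cs.simple i * cs.simple j) ^ k)⁻¹ * cs.simple j then 1 else 0) := by
  set p := cs.simple i * cs.simple j with hp
  have hpj (k : ℕ) : cs.simple j * p ^ k = (p ^ k)⁻¹ * cs.simple j := by
    induction k with
    | zero => simp
    | succ k ih =>
      rw [pow_succ, ← mul_assoc, ih, ← pow_succ, pow_succ', mul_inv_rev, mul_assoc, mul_assoc]
      simp [hp, mul_assoc]
  induction n with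
  | zero => simp
  | succ n ih =>
    rw [pow_succ', Equiv.Perm.mul_apply, ih, Equiv.Perm.mul_apply, signedConj_apply,
      signedConj_apply, Prod.mk.injEq]
    constructor
    · rw [pow_succ', hp]; simp [mul_assoc]
    · rw [show 2 * (n + 1) = 2 * n + 1 + 1 by ring, Finset.sum_range_succ, Finset.sum_range_succ,
        add_assoc, add_assoc, add_assoc]
      have h1 : p ^ n * t * (p ^ n)⁻¹ = cs.simple j ↔ t = (p ^ (2 * n))⁻¹ * cs.simple j := by
        rw [mul_inv_eq_iff_eq_mul, hpj, ← eq_inv_mul_iff_mul_eq, two_mul, pow_add,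
          mul_inv_rev, mul_assoc]
      have h2 : cs.simple j * (p ^ n * t * (p ^ n)⁻¹) * cs.simple j = cs.simple i ↔
          t = (p ^ (2 * n + 1))⁻¹ * cs.simple j := by
        have : cs.simple j * (p ^ n * t * (p ^ n)⁻¹) * cs.simple j = cs.simple i ↔
            p ^ n * t * (p ^ n)⁻¹ = p⁻¹ * cs.simple j := by
          rw [← mul_right_inj (cs.simple j), ← mul_left_inj (cs.simple j)]
          simp [hp, mul_assoc]
        rw [this, mul_inv_eq_iff_eq_mul, mul_assoc, hpj, ← eq_inv_mul_iff_mul_eq,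
          ← mul_assoc, ← mul_assoc, ← mul_inv_rev, ← mul_inv_rev, ← pow_succ', ← pow_add,
          show n + (n + 1) = 2 * n + 1 by ring]
      rw [if_congr h1 rfl rfl, if_congr h2 rfl rfl, add_assoc]

theorem isLiftable_signedConj : M.IsLiftable cs.signedConj := by
  classical
  intro i j
  ext1 ⟨t, ε⟩
  rw [signedConj_mul_pow_apply, two_mul, Finset.sum_range_add]
  simp only [pow_add, simple_mul_simple_pow, one_mul, inv_one, mul_one, Equiv.Perm.one_apply]
  rw [CharTwo.add_self_eq_zero, add_zero]

/-- The permutation representation of `W` on `W × ZMod 2` used to prove the strong exchange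
property. -/
noncomputable def signedConjHom : W →* Equiv.Perm (W × ZMod 2) :=
  cs.lift ⟨cs.signedConj, cs.isLiftable_signedConj⟩

theorem signedConjHom_simple (i : B) : cs.signedConjHom (cs.simple i) = cs.signedConj i :=
  cs.lift_apply_simple cs.isLiftable_signedConj i

open Classical in
theorem signedConjHom_wordProd_apply (ω : List B) (t : W) (ε : ZMod 2) :
    cs.signedConjHom (cs.wordProd ω) (t, ε) =
      (cs.wordProd ω * t * (cs.wordProd ω)⁻¹, ε + (cs.rightInvSeq ω).count t) := by
  induction ω with
  | nil => simp
  | cons i ω ih =>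
    rw [wordProd_cons, map_mul, Equiv.Perm.mul_apply, ih, signedConjHom_simple, signedConj_apply,
      rightInvSeq, count_cons]
    have h : cs.wordProd ω * t * (cs.wordProd ω)⁻¹ = cs.simple i ↔
        (cs.wordProd ω)⁻¹ * cs.simple i * cs.wordProd ω = t := by
      constructor <;> rintro h <;> simp [← h, mul_assoc]
    simp only [h, beq_iff_eq, Prod.mk.injEq]
    constructor
    · simp [mul_assoc]
    · push_cast; rw [add_assoc]

theorem signedConjHom_apply_fst (w t : W) (ε : ZMod 2) :
    (cs.signedConjHom w (t, ε)).1 = w * t * w⁻¹ := by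
  obtain ⟨ω, rfl⟩ := cs.wordProd_surjective w
  rw [signedConjHom_wordProd_apply]

theorem signedConjHom_apply_snd (w t : W) (ε : ZMod 2) :
    (cs.signedConjHom w (t, ε)).2 = ε + (cs.signedConjHom w (t, 0)).2 := by
  obtain ⟨ω, rfl⟩ := cs.wordProd_surjective w
  rw [signedConjHom_wordProd_apply, signedConjHom_wordProd_apply, zero_add]

theorem signedConjHom_apply (w t : W) (ε : ZMod 2) :
    cs.signedConjHom w (t, ε) = (w * t * w⁻¹, ε + (cs.signedConjHom w (t, 0)).2) :=
  Prod.ext (cs.signedConjHom_apply_fst w t ε) (cs.signedConjHom_apply_snd w t ε)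

theorem IsReflection.signedConjHom_self {cs : CoxeterSystem M W} {t : W}
    (ht : cs.IsReflection t) (ε : ZMod 2) : cs.signedConjHom t (t, ε) = (t, ε + 1) := by
  obtain ⟨w, i, rfl⟩ := ht
  obtain ⟨δ, hδ⟩ : ∃ δ, cs.signedConjHom w⁻¹ (w * cs.simple i * w⁻¹, ε) = (cs.simple i, δ) :=
    ⟨_, (cs.signedConjHom_apply _ _ _).trans (by simp [mul_assoc]; rfl)⟩
  have hw : cs.signedConjHom w (cs.simple i, δ) = (w * cs.simple i * w⁻¹, ε) := by
    rw [← hδ, ← Equiv.Perm.mul_apply, ← map_mul]; simp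
  rw [map_mul, map_mul, Equiv.Perm.mul_apply, Equiv.Perm.mul_apply, hδ, signedConjHom_simple,
    signedConj_apply, if_pos rfl, signedConjHom_apply, Prod.mk.injEq]
  rw [signedConjHom_apply, Prod.mk.injEq] at hw
  exact ⟨by simp, by rw [← hw.2, simple_mul_simple_self, one_mul]; ring⟩

theorem mem_rightInvSeq_of_signedConjHom_snd_ne_zero {ω : List B} {t : W}
    (h : (cs.signedConjHom (cs.wordProd ω) (t, 0)).2 ≠ 0) : t ∈ cs.rightInvSeq ω := by
  classical
  rw [signedConjHom_wordProd_apply] at h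
  by_contra hmem
  exact h (by simp [count_eq_zero_of_not_mem hmem])

theorem signedConjHom_snd_ne_zero_iff {t : W} (ht : cs.IsReflection t) (w : W) :
    (cs.signedConjHom w (t, 0)).2 ≠ 0 ↔ cs.IsRightInversion w t := by
  have key (v : W) (h : (cs.signedConjHom v (t, 0)).2 ≠ 0) : cs.IsRightInversion v t := by
    obtain ⟨ω, hω, rfl⟩ := cs.exists_isReduced v
    exact cs.isRightInversion_of_mem_rightInvSeq hω
      (cs.mem_rightInvSeq_of_signedConjHom_snd_ne_zero h)
  refine ⟨key w, fun hinv h0 => ?_⟩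
  refine ht.not_isRightInversion_mul_left_iff.mpr hinv (key (w * t) ?_)
  rw [map_mul, Equiv.Perm.mul_apply, ht.signedConjHom_self, signedConjHom_apply_snd, h0]
  decide

/-- The strong exchange property. -/
theorem IsRightInversion.exists_eraseIdx {cs : CoxeterSystem M W} {ω : List B} {t : W}
    (h : cs.IsRightInversion (cs.wordProd ω) t) :
    ∃ j < ω.length, cs.wordProd ω * t = cs.wordProd (ω.eraseIdx j) := by
  have hmem := cs.mem_rightInvSeq_of_signedConjHom_snd_ne_zero
    ((cs.signedConjHom_snd_ne_zero_iff h.1 _).mpr h)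
  obtain ⟨j, hj, rfl⟩ := getElem_of_mem hmem
  refine ⟨j, by simpa using hj, ?_⟩
  rw [← cs.wordProd_mul_getD_rightInvSeq, getD_eq_getElem _ _ hj]

theorem IsReflection.isRightInversion_mul_simple_iff {cs : CoxeterSystem M W} {t : W}
    (ht : cs.IsReflection t) (w : W) {i : B} (hti : t ≠ cs.simple i) :
    cs.IsRightInversion (w * cs.simple i) (cs.simple i * t * cs.simple i) ↔
      cs.IsRightInversion w t := by
  have ht' : cs.IsReflection (cs.simple i * t * cs.simple i) := by
    simpa using ht.conj (cs.simple i)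
  rw [← cs.signedConjHom_snd_ne_zero_iff ht, ← cs.signedConjHom_snd_ne_zero_iff ht',
    map_mul, Equiv.Perm.mul_apply, signedConjHom_simple, signedConj_apply, if_neg]
  · simp [mul_assoc]
  · rwa [mul_eq_right, mul_eq_one_iff_eq_inv', inv_simple]

/-- Every word has a reduced subword with the same product. -/
theorem exists_isReduced_sublist (ω : List B) :
    ∃ l : List B, l.Sublist ω ∧ cs.IsReduced l ∧ cs.wordProd l = cs.wordProd ω := by
  induction ω using List.reverseRecOn with
  | nil => exact ⟨[], Sublist.refl _, by simp [IsReduced], rfl⟩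
  | append_singleton ω i ih =>
    obtain ⟨l, hl, hred, hprod⟩ := ih
    by_cases hi : cs.IsRightDescent (cs.wordProd l) i
    · obtain ⟨j, hj, hj'⟩ :=
        ((cs.isRightInversion_simple_iff_isRightDescent _ _).mpr hi).exists_eraseIdx
      refine ⟨l.eraseIdx j, ((eraseIdx_sublist l j).trans hl).trans (sublist_append_left _ _),
        ?_, ?_⟩
      · rw [isRightDescent_iff, hj', hred] at hi
        rw [IsReduced, length_eraseIdx_of_lt hj]
        omega
      · rw [← hj', wordProd_append, hprod, wordProd_singleton]
    · refine ⟨l ++ [i], hl.append (Sublist.refl _), ?_, ?_⟩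
      · rw [not_isRightDescent_iff, hred] at hi
        simpa [IsReduced, wordProd_append] using hi
      · rw [wordProd_append, wordProd_append, hprod]

theorem mem_of_wordProd_eq_simple {i : B} {ω : List B} (h : cs.wordProd ω = cs.simple i) :
    i ∈ ω := by
  obtain ⟨l, hl, hred, hprod⟩ := cs.exists_isReduced_sublist ω
  have hlen : l.length = 1 := by rw [← hred.eq, hprod, h, length_simple]
  obtain ⟨k, rfl⟩ := List.length_eq_one_iff.mp hlen
  rw [h, wordProd_singleton] at hprod
  exact hl.subset (by simp [cs.simple_injective hprod])

/-- The letters of a reduced word occur in every word with the same product. -/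
theorem IsReduced.subset_of_wordProd_eq {cs : CoxeterSystem M W} {ω l : List B}
    (hω : cs.IsReduced ω) (h : cs.wordProd ω = cs.wordProd l) : ω ⊆ l := by
  induction ω using List.reverseRecOn generalizing l with
  | nil => simp
  | append_singleton ω i ih =>
    have hω' : cs.IsReduced ω := by simpa using hω.take ω.length
    rw [wordProd_append, wordProd_singleton] at h
    have hdesc : cs.IsRightDescent (cs.wordProd l) i := by
      rw [IsRightDescent, ← h, simple_mul_simple_cancel_right, hω'.eq]
      have := hω.eq
      rw [wordProd_append, wordProd_singleton] at this
      simp [this]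
    obtain ⟨j, hj, hj'⟩ :=
      ((cs.isRightInversion_simple_iff_isRightDescent _ _).mpr hdesc).exists_eraseIdx
    have hsub : l.eraseIdx j ⊆ l := (eraseIdx_sublist l j).subset
    have hi : i ∈ l.reverse ++ l.eraseIdx j := by
      apply cs.mem_of_wordProd_eq_simple
      rw [wordProd_append, wordProd_reverse, ← hj', inv_mul_cancel_left]
    have hmem : i ∈ l := by
      rcases mem_append.mp hi with hi | hi
      · exact mem_reverse.mp hi
      · exact hsub hi
    rw [append_subset]
    refine ⟨List.Subset.trans (ih hω' ?_) hsub, by simpa using hmem⟩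
    rw [← hj', ← h, simple_mul_simple_cancel_right]

theorem IsReduced.concat_of_notMem {cs : CoxeterSystem M W} {ω : List B} {i : B}
    (hω : cs.IsReduced ω) (hi : i ∉ ω) : cs.IsReduced (ω ++ [i]) := by
  by_cases hdesc : cs.IsRightDescent (cs.wordProd ω) i
  · obtain ⟨j, hj, hj'⟩ :=
      ((cs.isRightInversion_simple_iff_isRightDescent _ _).mpr hdesc).exists_eraseIdx
    have hmem : i ∈ ω.reverse ++ ω.eraseIdx j := by
      apply cs.mem_of_wordProd_eq_simple
      rw [wordProd_append, wordProd_reverse, ← hj', inv_mul_cancel_left]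
    rcases mem_append.mp hmem with h | h
    · exact absurd (mem_reverse.mp h) hi
    · exact absurd ((eraseIdx_sublist ω j).subset h) hi
  · rw [not_isRightDescent_iff, hω.eq] at hdesc
    simpa [IsReduced, wordProd_append] using hdesc

theorem IsReduced.append_of_disjoint {cs : CoxeterSystem M W} {ω l : List B}
    (hω : cs.IsReduced ω) (hl : l.Nodup) (hdisj : ω.Disjoint l) : cs.IsReduced (ω ++ l) := by
  induction l using List.reverseRecOn with
  | nil => simpa using hω
  | append_singleton l i ih =>
    rw [nodup_append] at hl
    rw [disjoint_append_right] at hdisj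
    rw [← append_assoc]
    refine (ih hl.1 hdisj.1).concat_of_notMem ?_
    rw [mem_append, not_or]
    exact ⟨fun h => hdisj.2 h (by simp), fun h => hl.2.2 i h i (by simp) rfl⟩

/-- `x` is obtained from the longer element `y` by right multiplication by a reflection. -/
def BruhatStep (x y : W) : Prop :=
  ∃ t, cs.IsReflection t ∧ y = x * t ∧ cs.length x < cs.length y

theorem BruhatStep.mul_simple {cs : CoxeterSystem M W} {x y : W} (h : cs.BruhatStep x y) (i : B) :
    x * cs.simple i = y ∨ cs.BruhatStep (x * cs.simple i) (y * cs.simple i) := by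
  obtain ⟨t, ht, rfl, hlt⟩ := h
  by_cases hti : t = cs.simple i
  · exact Or.inl (by rw [hti])
  · right
    have hinv : cs.IsRightInversion (x * t) t := ⟨ht, by rwa [mul_assoc, ht.mul_self, mul_one]⟩
    obtain ⟨ht', hlt'⟩ := (ht.isRightInversion_mul_simple_iff (x * t) hti).mpr hinv
    refine ⟨_, ht', by simp [mul_assoc], ?_⟩
    have : x * t * cs.simple i * (cs.simple i * t * cs.simple i) = x * cs.simple i := by
      rw [mul_assoc (cs.simple i), ← mul_assoc _ (cs.simple i) (t * _),
        simple_mul_simple_cancel_right, mul_assoc, ← mul_assoc t, ht.mul_self, one_mul]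
    rwa [this] at hlt'

open Relation

theorem reflTransGen_bruhatStep_mul_simple {x y : W} (h : ReflTransGen cs.BruhatStep x y) (i : B) :
    ReflTransGen cs.BruhatStep (x * cs.simple i) (y * cs.simple i) ∨
      ReflTransGen cs.BruhatStep (x * cs.simple i) y := by
  induction h using ReflTransGen.head_induction_on with
  | refl => exact Or.inl .refl
  | head hstep hrest ih =>
    rcases hstep.mul_simple i with h | h
    · exact Or.inr (h ▸ hrest)
    · exact ih.imp (.head h) (.head h)

theorem IsReduced.reflTransGen_bruhatStep {cs : CoxeterSystem M W} {ω l : List B}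
    (hω : cs.IsReduced ω) (hl : l.Sublist ω) :
    ReflTransGen cs.BruhatStep (cs.wordProd l) (cs.wordProd ω) := by
  induction ω using List.reverseRecOn generalizing l with
  | nil => rw [sublist_nil.mp hl]
  | append_singleton ω i ih =>
    have hω' : cs.IsReduced ω := by simpa using hω.take ω.length
    have hstep : cs.BruhatStep (cs.wordProd ω) (cs.wordProd (ω ++ [i])) :=
      ⟨_, cs.isReflection_simple i, by rw [wordProd_append, wordProd_singleton],
        by rw [hω.eq, hω'.eq]; simp⟩
    obtain ⟨l₁, l₂, rfl, hl₁, hl₂⟩ := sublist_append_iff.mp hl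
    rcases sublist_singleton.mp hl₂ with rfl | rfl
    · rw [append_nil]
      exact (ih hω' hl₁).tail hstep
    · rw [wordProd_append, wordProd_singleton]
      rcases cs.reflTransGen_bruhatStep_mul_simple (ih hω' hl₁) i with h | h
      · rwa [wordProd_append, wordProd_singleton]
      · exact h.tail hstep

theorem exists_sublist_of_reflTransGen_bruhatStep {u : W} {ω : List B}
    (h : ReflTransGen cs.BruhatStep u (cs.wordProd ω)) :
    ∃ l : List B, l.Sublist ω ∧ cs.wordProd l = u := by
  induction h using ReflTransGen.head_induction_on with
  | refl => exact ⟨ω, Sublist.refl _, rfl⟩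
  | @head x y hstep _ ih =>
    obtain ⟨l, hl, rfl⟩ := ih
    obtain ⟨t, ht, hy, hlt⟩ := hstep
    have hx : cs.wordProd l * t = x := by rw [hy, mul_assoc, ht.mul_self, mul_one]
    have hinv : cs.IsRightInversion (cs.wordProd l) t := ⟨ht, by rwa [hx]⟩
    obtain ⟨j, -, hj⟩ := hinv.exists_eraseIdx
    exact ⟨l.eraseIdx j, (eraseIdx_sublist l j).trans hl, hj ▸ hx⟩

/-- The subword property: if `u ≤ w`, then every word for `w` has a reduced subword for `u`. -/
theorem bruhatLE.exists_sublist {cs : CoxeterSystem M W} {u : W} {ω : List B}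
    (h : cs.bruhatLE u (cs.wordProd ω)) :
    ∃ l : List B, l.Sublist ω ∧ cs.IsReduced l ∧ cs.wordProd l = u := by
  obtain ⟨ω', hω', hprod, l', hl', rfl⟩ := h
  have hchain := hω'.reflTransGen_bruhatStep hl'
  rw [hprod] at hchain
  obtain ⟨l, hl, hlprod⟩ := cs.exists_sublist_of_reflTransGen_bruhatStep hchain
  obtain ⟨k, hk, hkred, hkprod⟩ := cs.exists_isReduced_sublist l
  exact ⟨k, hk.trans hl, hkred, hkprod.trans hlprod⟩

theorem bruhatLE_one_left (w : W) : cs.bruhatLE 1 w := by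
  obtain ⟨ω, hω, rfl⟩ := cs.exists_isReduced w
  exact ⟨ω, hω, rfl, [], nil_sublist _, cs.wordProd_nil⟩

open Classical in
/-- The subword of `l` consisting of the letters at the positions in `A`. -/
noncomputable def subword (l : List B) (A : Finset (Fin l.length)) : List B :=
  ((finRange l.length).filter (· ∈ A)).map l.get

theorem subword_sublist (l : List B) (A : Finset (Fin l.length)) : (subword l A).Sublist l := by
  conv_rhs => rw [← map_get_finRange l]
  exact filter_sublist.map _

theorem subword_sublist_subword (l : List B) {A A' : Finset (Fin l.length)} (h : A ⊆ A') :
    (subword l A).Sublist (subword l A') := by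
  classical
  refine Sublist.map _ ?_
  exact monotone_filter_right _ fun k hk => by simpa using h (by simpa using hk)

theorem get_mem_subword_iff {l : List B} (hl : l.Nodup) {A : Finset (Fin l.length)}
    {k : Fin l.length} : l.get k ∈ subword l A ↔ k ∈ A := by
  simp only [subword, mem_map, mem_filter, mem_finRange, true_and, decide_eq_true_eq]
  exact ⟨fun ⟨k', hk', h⟩ => hl.injective_get h ▸ hk', fun h => ⟨k, h, rfl⟩⟩

theorem exists_eq_subword_of_sublist {l l' : List B} (h : l'.Sublist l) :
    ∃ A, l' = subword l A := by
  classical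
  rw [← map_get_finRange l] at h
  obtain ⟨f, hf, rfl⟩ := sublist_map_iff.mp h
  refine ⟨f.toFinset, congrArg (map l.get) (Sublist.eq_of_length_le ?_ ?_)⟩
  · have h := hf.filter (· ∈ f.toFinset)
    rwa [filter_eq_self.mpr fun k hk => decide_eq_true (mem_toFinset.mpr hk)] at h
  · exact (((nodup_finRange _).filter _).subperm fun k hk => by simpa using hk).length_le

/-- Appending to a reduced word `ω` a word `l` with distinct letters not occurring in `ω` yields a
Boolean Bruhat interval. -/
theorem exists_bruhat_interval_equiv_finset {ω l : List B} (hω : cs.IsReduced ω) (hl : l.Nodup)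
    (hdisj : ω.Disjoint l) :
    ∃ g : {z : W // cs.bruhatLE (cs.wordProd ω) z ∧ cs.bruhatLE z (cs.wordProd (ω ++ l))} ≃
        Finset (Fin l.length),
      ∀ a b, cs.bruhatLE a.1 b.1 ↔ g a ⊆ g b := by
  have hdisj' (A) : ω.Disjoint (subword l A) :=
    disjoint_of_subset_right (subword_sublist l A).subset hdisj
  have hred (A) : cs.IsReduced (ω ++ subword l A) :=
    hω.append_of_disjoint (hl.sublist (subword_sublist l A)) (hdisj' A)
  have hle (A A') : cs.bruhatLE (cs.wordProd (ω ++ subword l A))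
      (cs.wordProd (ω ++ subword l A')) ↔ A ⊆ A' := by
    constructor
    · intro h k hk
      obtain ⟨x, hx, -, hprod⟩ := h.exists_sublist
      have hmem : l.get k ∈ ω ++ subword l A' :=
        hx.subset ((hred A).subset_of_wordProd_eq hprod.symm
          (mem_append_right _ ((get_mem_subword_iff hl).mpr hk)))
      rcases mem_append.mp hmem with h | h
      · exact absurd (get_mem l k) (hdisj h)
      · exact (get_mem_subword_iff hl).mp h
    · exact fun h => ⟨_, hred A', rfl, _,
        (Sublist.refl ω).append (subword_sublist_subword l h), rfl⟩
  let φ (A : Finset (Fin l.length)) :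
      {z : W // cs.bruhatLE (cs.wordProd ω) z ∧ cs.bruhatLE z (cs.wordProd (ω ++ l))} :=
    ⟨cs.wordProd (ω ++ subword l A), ⟨_, hred A, rfl, ω, sublist_append_left _ _, rfl⟩,
      ⟨_, hω.append_of_disjoint hl hdisj, rfl, _,
        (Sublist.refl ω).append (subword_sublist l A), rfl⟩⟩
  have hφle (A A') : cs.bruhatLE (φ A : W) (φ A' : W) ↔ A ⊆ A' := hle A A'
  have hinj : Function.Injective φ := fun A A' h =>
    ((hφle A A').mp (h ▸ (hφle A A).mpr subset_rfl)).antisymm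
      ((hφle A' A).mp (h ▸ (hφle A A).mpr subset_rfl))
  have hsurj : Function.Surjective φ := by
    rintro ⟨z, hz₁, hz₂⟩
    obtain ⟨x, hx, -, rfl⟩ := hz₂.exists_sublist
    obtain ⟨α, β, rfl, hα, hβ⟩ := sublist_append_iff.mp hx
    obtain ⟨γ, hγ, hγred, hγprod⟩ := hz₁.exists_sublist
    obtain ⟨γ₁, γ₂, rfl, hγ₁, hγ₂⟩ := sublist_append_iff.mp hγ
    have hγω := hγred.subset_of_wordProd_eq hγprod
    have hnil : γ₂ = [] := by
      rw [eq_nil_iff_forall_not_mem]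
      exact fun i hi => hdisj (hγω (mem_append_right _ hi)) ((hγ₂.trans hβ).subset hi)
    subst hnil
    rw [append_nil] at hγred hγprod
    have hlen : γ₁.length = ω.length := by rw [← hγred.eq, hγprod, hω.eq]
    have hαω : α = ω := hα.eq_of_length (le_antisymm hα.length_le (hlen ▸ hγ₁.length_le))
    obtain ⟨A, rfl⟩ := exists_eq_subword_of_sublist hβ
    subst hαω
    exact ⟨A, rfl⟩
  refine ⟨(Equiv.ofBijective φ ⟨hinj, hsurj⟩).symm, fun a b => ?_⟩
  obtain ⟨A, rfl⟩ := hsurj a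
  obtain ⟨A', rfl⟩ := hsurj b
  rw [hφle]
  simp only [← Equiv.ofBijective_apply φ ⟨hinj, hsurj⟩, Equiv.symm_apply_apply]

theorem exists_word_of_mem_parabolic {J : Set B} {w : W} (hw : w ∈ cs.parabolic J) :
    ∃ ω : List B, (∀ i ∈ ω, i ∈ J) ∧ cs.IsReduced ω ∧ cs.wordProd ω = w := by
  suffices ∃ ω : List B, (∀ i ∈ ω, i ∈ J) ∧ cs.wordProd ω = w by
    obtain ⟨ω, hω, rfl⟩ := this
    obtain ⟨l, hl, hred, hprod⟩ := cs.exists_isReduced_sublist ω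
    exact ⟨l, fun i hi => hω i (hl.subset hi), hred, hprod⟩
  induction hw using Subgroup.closure_induction with
  | mem x hx =>
    obtain ⟨i, hi, rfl⟩ := hx
    exact ⟨[i], by simpa using hi, cs.wordProd_singleton i⟩
  | one => exact ⟨[], by simp, cs.wordProd_nil⟩
  | mul x y _ _ hx hy =>
    obtain ⟨α, hα, rfl⟩ := hx
    obtain ⟨β, hβ, rfl⟩ := hy
    exact ⟨α ++ β, fun i hi => (mem_append.mp hi).elim (hα i) (hβ i), cs.wordProd_append α β⟩
  | inv x _ hx =>
    obtain ⟨α, hα, rfl⟩ := hx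
    exact ⟨α.reverse, fun i hi => hα i (mem_reverse.mp hi), cs.wordProd_reverse α⟩

end CoxeterSystem

theorem upper_bruhat_interval_is_boolean
    (cs : CoxeterSystem M W) (J : Set B)
    (hfin : Finite (cs.parabolic J))
    (w0J : W) (hw0J : w0J ∈ cs.parabolic J)
    (hw0Jmax : ∀ u ∈ cs.parabolic J, cs.length u ≤ cs.length w0J)
    (c : W) (r : ℕ) (hc : ∃ l : List B, l.Nodup ∧ l.length = r ∧ cs.wordProd l = c)
    (hcr : cs.length c = r)
    (hdisj : cs.support c ∩ J = ∅)
    (w : W) (hw : w = w0J * c)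
    (hlen : cs.length w = cs.length w0J + r) :
    (∃ f : {z : W // cs.bruhatLE w0J z ∧ cs.bruhatLE z w} ≃ {v : W // cs.bruhatLE v c},
      ∀ a b : {z : W // cs.bruhatLE w0J z ∧ cs.bruhatLE z w},
        cs.bruhatLE (a : W) (b : W) ↔ cs.bruhatLE ((f a) : W) ((f b) : W)) ∧
    (∃ g : {z : W // cs.bruhatLE w0J z ∧ cs.bruhatLE z w} ≃ Finset (Fin r),
      ∀ a b : {z : W // cs.bruhatLE w0J z ∧ cs.bruhatLE z w},
        cs.bruhatLE (a : W) (b : W) ↔ g a ⊆ g b) := by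
  obtain ⟨l, hl, rfl, rfl⟩ := hc
  obtain ⟨ω, hωJ, hω, rfl⟩ := cs.exists_word_of_mem_parabolic hw0J
  have hdisjoint : ω.Disjoint l := fun i hi hi' =>
    Set.eq_empty_iff_forall_notMem.mp hdisj i ⟨⟨l, hcr, rfl, hi'⟩, hωJ i hi⟩
  rw [← cs.wordProd_append] at hw
  subst hw
  obtain ⟨g, hg⟩ := cs.exists_bruhat_interval_equiv_finset hω hl hdisjoint
  obtain ⟨g', hg'⟩ := cs.exists_bruhat_interval_equiv_finset (ω := []) (l := l)
    (by simp [CoxeterSystem.IsReduced]) hl (by simp)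
  let e : {v : W // cs.bruhatLE v (cs.wordProd l)} ≃
      {v : W // cs.bruhatLE (cs.wordProd []) v ∧ cs.bruhatLE v (cs.wordProd ([] ++ l))} :=
    Equiv.subtypeEquivRight fun v => by simp [cs.bruhatLE_one_left]
  refine ⟨⟨g.trans (e.trans g').symm, fun a b => ?_⟩, g, hg⟩
  have he (v) : (e v : W) = v := rfl
  rw [hg, ← he, ← he, hg']
  simp
end

section
/- Let k be a field, let w = s_{i_1}s_{i_2}⋯s_{i_r} be a reduced expression of an element w ∈ W whose support consists of exactly m distinct simple reflections, and let β_j := s_{i_1}⋯s_{i_{j-1}}(α_{i_j}) for 1 ≤ j ≤ r. Then the subgroup {φ ∈ Hom_ℤ(Λ, kˣ) : φ(β_j) = 1 for all 1 ≤ j ≤ r} of the group Hom_ℤ(Λ, kˣ) is isomorphic, as an abstract group, to (kˣ)^{n−m}. -/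
/-!
Statement 8. Let `k` be a field, `w = s_{i_1} ⋯ s_{i_r}` a reduced expression whose support
consists of exactly `m` distinct simple reflections, and `β_j := s_{i_1} ⋯ s_{i_{j-1}}(α_{i_j})`.
Then the subgroup `{φ ∈ Hom_ℤ(Λ, kˣ) : φ(β_j) = 1 for all j}` of `Hom_ℤ(Λ, kˣ)` is
isomorphic, as an abstract group, to `(kˣ)^{n−m}`.
-/

/-- The root lattice `Λ = ℤα_1 ⊕ ⋯ ⊕ ℤα_n`. -/
abbrev RootLattice (n : ℕ) := Fin n → ℤ

/-- The simple root `α_i`, as a basis vector of the root lattice. -/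
def simpleRoot {n : ℕ} (i : Fin n) : RootLattice n := Pi.single i 1

/-- The simple reflection `s_i` acting on the root lattice:
`s_i(x) = x - ⟨x, α_i^∨⟩ α_i`, where `⟨α_j, α_i^∨⟩ = A j i` is an entry of the Cartan
matrix `A`. -/
def simpleRefl {n : ℕ} (A : Matrix (Fin n) (Fin n) ℤ) (i : Fin n) :
    Module.End ℤ (RootLattice n) :=
  LinearMap.id - (∑ j, A j i • LinearMap.proj j).smulRight (simpleRoot i)

/-- The endomorphism of the root lattice given by a word in the simple reflections. -/
def reflWord {n : ℕ} (A : Matrix (Fin n) (Fin n) ℤ) (l : List (Fin n)) :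
    Module.End ℤ (RootLattice n) :=
  (l.map (simpleRefl A)).prod

/-- The length of `w` with respect to the simple reflections. -/
noncomputable def lengthW {n : ℕ} (A : Matrix (Fin n) (Fin n) ℤ)
    (w : Module.End ℤ (RootLattice n)) : ℕ :=
  sInf {r : ℕ | ∃ l : List (Fin n), l.length = r ∧ reflWord A l = w}

/-- `l` is a reduced word. -/
def IsReducedWord {n : ℕ} (A : Matrix (Fin n) (Fin n) ℤ) (l : List (Fin n)) : Prop :=
  lengthW A (reflWord A l) = l.length

/-- The support of `w`: the set of (indices of) simple reflections appearing in some
(equivalently, any) reduced expression of `w`. -/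
def suppW {n : ℕ} (A : Matrix (Fin n) (Fin n) ℤ) (w : Module.End ℤ (RootLattice n)) :
    Set (Fin n) :=
  {i : Fin n | ∃ l : List (Fin n), IsReducedWord A l ∧ reflWord A l = w ∧ i ∈ l}

/-- The Weyl group, as a submonoid of the endomorphisms of the root lattice (each simple
reflection being an involution, this submonoid is in fact a group). -/
def weylMonoid {n : ℕ} (A : Matrix (Fin n) (Fin n) ℤ) :
    Submonoid (Module.End ℤ (RootLattice n)) :=
  Submonoid.closure (Set.range (simpleRefl A))

/-- The subgroup of `Hom_ℤ(Λ, kˣ)` consisting of the homomorphisms killing every element of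
the set `S`. -/
def jointKernel {n : ℕ} (k : Type*) [Field k] (S : Set (RootLattice n)) :
    Subgroup (Multiplicative (RootLattice n) →* kˣ) where
  carrier := {φ | ∀ x ∈ S, φ (Multiplicative.ofAdd x) = 1}
  one_mem' := by intro x hx; simp
  mul_mem' := by intro a b ha hb x hx; simp [ha x hx, hb x hx]
  inv_mem' := by intro a ha x hx; simp [ha x hx]

/-- The pairing `⟨x, α_i^∨⟩` of a lattice vector with a simple coroot. -/
def corootPairing {n : ℕ} (A : Matrix (Fin n) (Fin n) ℤ) (i : Fin n) (x : RootLattice n) : ℤ :=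
  ∑ j, A j i * x j

section Reflections

variable {n : ℕ} {A : Matrix (Fin n) (Fin n) ℤ}

theorem simpleRefl_apply (i : Fin n) (x : RootLattice n) :
    simpleRefl A i x = x - corootPairing A i x • simpleRoot i := by
  simp [simpleRefl, corootPairing]

theorem corootPairing_simpleRoot (i j : Fin n) : corootPairing A i (simpleRoot j) = A j i := by
  simp [corootPairing, simpleRoot, Pi.single_apply]

theorem simpleRefl_simpleRoot (hdiag : ∀ i, A i i = 2) (i : Fin n) :
    simpleRefl A i (simpleRoot i) = -simpleRoot i := by
  rw [simpleRefl_apply, corootPairing_simpleRoot, hdiag]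
  module

theorem simpleRefl_mul_self (hdiag : ∀ i, A i i = 2) (i : Fin n) :
    simpleRefl A i * simpleRefl A i = 1 := by
  refine LinearMap.ext fun x => ?_
  rw [Module.End.mul_apply, Module.End.one_apply, simpleRefl_apply (x := x), map_sub, map_smul,
    simpleRefl_simpleRoot hdiag, simpleRefl_apply]
  module

theorem simpleRefl_mem (i : Fin n) : simpleRefl A i ∈ weylMonoid A :=
  Submonoid.subset_closure ⟨i, rfl⟩

@[simp] theorem reflWord_nil : reflWord A [] = 1 := rfl

@[simp] theorem reflWord_cons (i : Fin n) (l : List (Fin n)) :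
    reflWord A (i :: l) = simpleRefl A i * reflWord A l := by
  simp [reflWord]

@[simp] theorem reflWord_append (l l' : List (Fin n)) :
    reflWord A (l ++ l') = reflWord A l * reflWord A l' := by
  simp [reflWord]

theorem reflWord_ne_zero (hdiag : ∀ i, A i i = 2) (l : List (Fin n)) {x : RootLattice n}
    (hx : x ≠ 0) : reflWord A l x ≠ 0 := by
  induction l with
  | nil => simpa
  | cons i l ih =>
    intro h
    apply ih
    have := congrArg (simpleRefl A i) h
    rwa [reflWord_cons, ← Module.End.mul_apply, ← mul_assoc, simpleRefl_mul_self hdiag, one_mul,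
      map_zero] at this

theorem simpleRoot_ne_zero (i : Fin n) : (simpleRoot i : RootLattice n) ≠ 0 := by
  simp [simpleRoot]

theorem simpleRefl_apply_of_ne {i j : Fin n} (h : j ≠ i) (x : RootLattice n) :
    simpleRefl A i x j = x j := by
  simp [simpleRefl_apply, simpleRoot, h]

theorem reflWord_apply_of_notMem {i : Fin n} {l : List (Fin n)} (h : i ∉ l)
    (x : RootLattice n) : reflWord A l x i = x i := by
  induction l with
  | nil => simp
  | cons j l ih =>
    simp only [List.mem_cons, not_or] at h
    rw [reflWord_cons, Module.End.mul_apply, simpleRefl_apply_of_ne h.1, ih h.2]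

theorem sum_smul_simpleRoot (x : RootLattice n) : ∑ i, x i • simpleRoot i = x := by
  ext j
  simp [simpleRoot, Pi.single_apply]

end Reflections

/-- A positive definite symmetric integral form invariant under the simple reflections. -/
structure IsInvariantForm {n : ℕ} (A : Matrix (Fin n) (Fin n) ℤ)
    (B : RootLattice n →ₗ[ℤ] RootLattice n →ₗ[ℤ] ℤ) : Prop where
  symm : ∀ x y, B x y = B y x
  pos : ∀ x, x ≠ 0 → 0 < B x x
  invariant : ∀ i x y, B (simpleRefl A i x) (simpleRefl A i y) = B x y

theorem exists_isInvariantForm {n : ℕ} {A : Matrix (Fin n) (Fin n) ℤ} (hdiag : ∀ i, A i i = 2)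
    (hfin : Finite (weylMonoid A)) : ∃ B, IsInvariantForm A B := by
  have := Fintype.ofFinite (weylMonoid A)
  refine ⟨LinearMap.mk₂ ℤ (fun x y => ∑ g : weylMonoid A, g.1 x ⬝ᵥ g.1 y) ?_ ?_ ?_ ?_, ?_, ?_, ?_⟩
  · intro x y z
    simp [add_dotProduct, Finset.sum_add_distrib]
  · intro c x y
    simp [-zsmul_eq_mul, smul_dotProduct, Finset.mul_sum]
  · intro x y z
    simp [dotProduct_add, Finset.sum_add_distrib]
  · intro c x y
    simp [-zsmul_eq_mul, dotProduct_smul, Finset.mul_sum]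
  · intro x y
    simp only [LinearMap.mk₂_apply]
    exact Finset.sum_congr rfl fun g _ => dotProduct_comm _ _
  · intro x hx
    simp only [LinearMap.mk₂_apply]
    have hnonneg : ∀ y : RootLattice n, 0 ≤ y ⬝ᵥ y := fun y =>
      Finset.sum_nonneg fun i _ => mul_self_nonneg _
    refine Finset.sum_pos' (fun g _ => hnonneg _) ⟨1, Finset.mem_univ _, ?_⟩
    refine lt_of_le_of_ne (hnonneg _) fun h => hx ?_
    simpa using dotProduct_self_eq_zero.mp h.symm
  · intro i x y
    simp only [LinearMap.mk₂_apply]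
    have hinv : Function.Involutive
        (fun g : weylMonoid A => g * ⟨simpleRefl A i, simpleRefl_mem i⟩) := fun g => by
      apply Subtype.ext
      simp [mul_assoc, simpleRefl_mul_self hdiag]
    exact Fintype.sum_bijective _ hinv.bijective _ _ fun g => rfl

namespace IsInvariantForm

variable {n : ℕ} {A : Matrix (Fin n) (Fin n) ℤ} {B : RootLattice n →ₗ[ℤ] RootLattice n →ₗ[ℤ] ℤ}

theorem two_mul_apply_simpleRoot (hB : IsInvariantForm A B) (hdiag : ∀ i, A i i = 2)
    (x : RootLattice n) (i : Fin n) :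
    2 * B x (simpleRoot i) = corootPairing A i x * B (simpleRoot i) (simpleRoot i) := by
  have h := hB.invariant i x (simpleRoot i)
  rw [simpleRefl_simpleRoot hdiag, simpleRefl_apply] at h
  simp only [map_sub, map_neg, map_smul, LinearMap.sub_apply, LinearMap.smul_apply,
    smul_eq_mul] at h
  linarith

theorem reflWord_invariant (hB : IsInvariantForm A B) (l : List (Fin n)) (x y : RootLattice n) :
    B (reflWord A l x) (reflWord A l y) = B x y := by
  induction l with
  | nil => simp
  | cons i l ih => rw [reflWord_cons, Module.End.mul_apply, Module.End.mul_apply, hB.invariant, ih]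

/-- The coefficients of a real coroot in terms of simple coroots are integral. -/
theorem dvd_reflWord_simpleRoot (hB : IsInvariantForm A B) (hdiag : ∀ i, A i i = 2)
    (l : List (Fin n)) (m i : Fin n) :
    B (simpleRoot m) (simpleRoot m) ∣
      reflWord A l (simpleRoot m) i * B (simpleRoot i) (simpleRoot i) := by
  induction l generalizing i with
  | nil =>
    by_cases h : i = m
    · subst h
      exact dvd_mul_left _ _
    · simp [simpleRoot, h]
  | cons j l ih =>
    rw [reflWord_cons, Module.End.mul_apply]
    generalize reflWord A l (simpleRoot m) = x at *
    by_cases h : i = j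
    · subst h
      have hx : simpleRefl A i x i = x i - corootPairing A i x := by
        simp [simpleRefl_apply, simpleRoot]
      rw [hx, sub_mul, corootPairing, Finset.sum_mul]
      refine dvd_sub (ih i) (Finset.dvd_sum fun k _ => ?_)
      have h1 := hB.two_mul_apply_simpleRoot hdiag (simpleRoot k) i
      have h2 := hB.two_mul_apply_simpleRoot hdiag (simpleRoot i) k
      rw [corootPairing_simpleRoot] at h1 h2
      rw [hB.symm] at h1
      have h3 : A k i * x k * B (simpleRoot i) (simpleRoot i) =
          A i k * (x k * B (simpleRoot k) (simpleRoot k)) := by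
        linear_combination x k * (h2 - h1)
      rw [h3]
      exact (ih k).mul_left _
    · rw [simpleRefl_apply_of_ne h]
      exact ih i

theorem dvd_apply_self_sum (hB : IsInvariantForm A B) (hdiag : ∀ i, A i i = 2) {N : ℤ}
    {x : RootLattice n} (hx : ∀ i, N ∣ x i * B (simpleRoot i) (simpleRoot i))
    (s : Finset (Fin n)) :
    N ∣ B (∑ i ∈ s, x i • simpleRoot i) (∑ i ∈ s, x i • simpleRoot i) := by
  induction s using Finset.induction_on with
  | empty => simp
  | insert a s ha ih =>
    rw [Finset.sum_insert ha]
    generalize ∑ i ∈ s, x i • simpleRoot i = p at *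
    have h := hB.two_mul_apply_simpleRoot hdiag p a
    have key : B (x a • simpleRoot a + p) (x a • simpleRoot a + p) =
        B p p + (x a + corootPairing A a p) * (x a * B (simpleRoot a) (simpleRoot a)) := by
      simp only [map_add, map_smul, LinearMap.add_apply, LinearMap.smul_apply, smul_eq_mul,
        hB.symm (simpleRoot a) p]
      linear_combination x a * h
    rw [key]
    exact dvd_add ih ((hx a).mul_left _)

/-- Every real root is either nonnegative or nonpositive. -/
theorem sign_coherent (hB : IsInvariantForm A B) (hdiag : ∀ i, A i i = 2)
    (hoff : ∀ i j, i ≠ j → A i j ≤ 0) (l : List (Fin n)) (m : Fin n) :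
    (∀ i, 0 ≤ reflWord A l (simpleRoot m) i) ∨ (∀ i, reflWord A l (simpleRoot m) i ≤ 0) := by
  have hdvd := hB.dvd_reflWord_simpleRoot hdiag l m
  have hnorm := hB.reflWord_invariant l (simpleRoot m) (simpleRoot m)
  have hN := hB.pos _ (simpleRoot_ne_zero m)
  generalize reflWord A l (simpleRoot m) = x at *
  generalize B (simpleRoot m) (simpleRoot m) = N at *
  set s : Finset (Fin n) := Finset.univ.filter fun i => 0 < x i with hs
  have hp := hB.dvd_apply_self_sum hdiag hdvd s
  have hq := hB.dvd_apply_self_sum hdiag hdvd sᶜ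
  have hsum : ∑ i ∈ s, x i • simpleRoot i + ∑ i ∈ sᶜ, x i • simpleRoot i = x := by
    rw [Finset.sum_add_sum_compl, sum_smul_simpleRoot]
  have hcross : 0 ≤ B (∑ i ∈ s, x i • simpleRoot i) (∑ i ∈ sᶜ, x i • simpleRoot i) := by
    simp only [map_sum, LinearMap.sum_apply, map_smul, LinearMap.smul_apply, smul_eq_mul]
    refine Finset.sum_nonneg fun j hj => ?_
    rw [Finset.mul_sum]
    refine Finset.sum_nonneg fun i hi => ?_
    have hxi : 0 < x i := by simpa [hs] using hi
    have hxj : x j ≤ 0 := by simpa [hs] using hj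
    have hij : i ≠ j := by
      rintro rfl
      omega
    have h := hB.two_mul_apply_simpleRoot hdiag (simpleRoot i) j
    rw [corootPairing_simpleRoot] at h
    have hBij : B (simpleRoot i) (simpleRoot j) ≤ 0 := by
      have := mul_nonpos_of_nonpos_of_nonneg (hoff i j hij) (hB.pos _ (simpleRoot_ne_zero j)).le
      linarith
    exact mul_nonneg_of_nonpos_of_nonpos hxj (mul_nonpos_of_nonneg_of_nonpos hxi.le hBij)
  have hcoord : ∀ (t : Finset (Fin n)), ∑ i ∈ t, x i • simpleRoot i = 0 → ∀ i ∈ t, x i = 0 := by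
    intro t ht i hi
    have := congrFun ht i
    simpa [simpleRoot, Pi.single_apply, hi] using this
  by_cases hp0 : ∑ i ∈ s, x i • simpleRoot i = (0 : RootLattice n)
  · right
    intro i
    by_contra! hi
    have := hcoord s hp0 i (by simpa [hs] using hi)
    omega
  by_cases hq0 : ∑ i ∈ sᶜ, x i • simpleRoot i = (0 : RootLattice n)
  · left
    intro i
    by_contra! hi
    have := hcoord sᶜ hq0 i (by simpa [hs] using hi.le)
    omega
  exfalso
  have h1 := Int.le_of_dvd (hB.pos _ hp0) hp
  have h2 := Int.le_of_dvd (hB.pos _ hq0) hq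
  rw [← hsum] at hnorm
  simp only [map_add, LinearMap.add_apply] at hnorm
  rw [hB.symm (∑ i ∈ sᶜ, x i • simpleRoot i) (∑ i ∈ s, x i • simpleRoot i)] at hnorm
  linarith

/-- A positive real root made negative by `s_i` is `α_i`. -/
theorem eq_simpleRoot_of_neg (hB : IsInvariantForm A B) (hdiag : ∀ i, A i i = 2)
    (hoff : ∀ i j, i ≠ j → A i j ≤ 0) (l : List (Fin n)) (i m : Fin n)
    (hpos : ∀ k, 0 ≤ reflWord A l (simpleRoot m) k)
    (hneg : ∃ k, reflWord A (i :: l) (simpleRoot m) k < 0) :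
    reflWord A l (simpleRoot m) = simpleRoot i := by
  obtain ⟨k, hk⟩ := hneg
  have hle : ∀ j, reflWord A (i :: l) (simpleRoot m) j ≤ 0 :=
    (hB.sign_coherent hdiag hoff (i :: l) m).resolve_left fun h => (h k).not_gt hk
  have hdvd := hB.dvd_reflWord_simpleRoot hdiag l m i
  rw [← hB.reflWord_invariant l (simpleRoot m) (simpleRoot m)] at hdvd
  have hne := reflWord_ne_zero hdiag l (simpleRoot_ne_zero m)
  rw [reflWord_cons] at hle
  simp only [Module.End.mul_apply] at hle
  generalize reflWord A l (simpleRoot m) = x at *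
  have hzero : ∀ j, j ≠ i → x j = 0 := fun j hj => by
    have h1 := hle j
    rw [simpleRefl_apply_of_ne hj] at h1
    exact le_antisymm h1 (hpos j)
  have hx : x = x i • simpleRoot i := by
    ext j
    by_cases h : j = i
    · subst h
      simp [simpleRoot]
    · simp [simpleRoot, h, hzero j h]
  have hxi : 0 < x i := lt_of_le_of_ne (hpos i) fun h => hne (by rw [hx, ← h, zero_smul])
  have hb := hB.pos _ (simpleRoot_ne_zero (n := n) i)
  have hxx : B x x = x i * (x i * B (simpleRoot i) (simpleRoot i)) := by
    conv_lhs => rw [hx]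
    simp [-zsmul_eq_mul]
  rw [hxx] at hdvd
  have h1 := Int.le_of_dvd (by positivity) hdvd
  have h2 : x i = 1 := by
    have : 0 < x i * B (simpleRoot i) (simpleRoot i) := by positivity
    nlinarith
  rw [hx, h2, one_smul]

theorem simpleRefl_mul_of_apply_eq (hB : IsInvariantForm A B) (hdiag : ∀ i, A i i = 2)
    {l : List (Fin n)} {i m : Fin n} (h : reflWord A l (simpleRoot m) = simpleRoot i) :
    simpleRefl A i * reflWord A l = reflWord A l * simpleRefl A m := by
  refine LinearMap.ext fun x => ?_
  have h1 := hB.two_mul_apply_simpleRoot hdiag (reflWord A l x) i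
  have h2 := hB.two_mul_apply_simpleRoot hdiag x m
  rw [← h, hB.reflWord_invariant, hB.reflWord_invariant, h2] at h1
  have h3 := mul_right_cancel₀ (hB.pos _ (simpleRoot_ne_zero m)).ne' h1
  rw [Module.End.mul_apply, Module.End.mul_apply, simpleRefl_apply, simpleRefl_apply, map_sub,
    map_smul, h, h3]

theorem exists_shorter_word (hB : IsInvariantForm A B) (hdiag : ∀ i, A i i = 2)
    (hoff : ∀ i j, i ≠ j → A i j ≤ 0) (l : List (Fin n)) (m : Fin n)
    (hneg : ∃ k, reflWord A l (simpleRoot m) k < 0) :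
    ∃ l' : List (Fin n), l'.length < l.length ∧ reflWord A l' = reflWord A (l ++ [m]) := by
  induction l with
  | nil =>
    obtain ⟨k, hk⟩ := hneg
    have : (0 : RootLattice n) ≤ simpleRoot m := Pi.single_nonneg.mpr zero_le_one
    exact absurd hk (this k).not_gt
  | cons i l ih =>
    by_cases h : ∃ k, reflWord A l (simpleRoot m) k < 0
    · obtain ⟨l', hlen, hl'⟩ := ih h
      exact ⟨i :: l', by simpa using hlen, by rw [reflWord_cons, hl', List.cons_append,
        reflWord_cons]⟩
    · push Not at h
      have hi := hB.simpleRefl_mul_of_apply_eq hdiag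
        (hB.eq_simpleRoot_of_neg hdiag hoff l i m h hneg)
      refine ⟨l, by simp, ?_⟩
      simp only [List.cons_append, reflWord_cons, reflWord_append, reflWord_nil, mul_one]
      rw [← hi, ← mul_assoc, simpleRefl_mul_self hdiag, one_mul]

end IsInvariantForm

section ReducedWords

variable {n : ℕ} {A : Matrix (Fin n) (Fin n) ℤ}

theorem isReducedWord_iff {l : List (Fin n)} :
    IsReducedWord A l ↔ ∀ l', reflWord A l' = reflWord A l → l.length ≤ l'.length := by
  have hle : ∀ l', reflWord A l' = reflWord A l → lengthW A (reflWord A l) ≤ l'.length :=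
    fun l' h => Nat.sInf_le ⟨l', rfl, h⟩
  constructor
  · intro h l' hl'
    exact h ▸ hle l' hl'
  · intro h
    refine le_antisymm (hle l rfl) (le_csInf ⟨_, l, rfl, rfl⟩ ?_)
    rintro _ ⟨l', rfl, hl'⟩
    exact h l' hl'

theorem IsReducedWord.of_append {l l' : List (Fin n)} (h : IsReducedWord A (l ++ l')) :
    IsReducedWord A l := by
  rw [isReducedWord_iff] at h ⊢
  intro l'' hl''
  have := h (l'' ++ l') (by simp [hl''])
  simpa using this

/-- The simple reflections in a reduced word occur in every word for the same element. -/
theorem IsReducedWord.notMem_of_reflWord_eq (hdiag : ∀ i, A i i = 2)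
    (hoff : ∀ i j, i ≠ j → A i j ≤ 0) (hfin : Finite (weylMonoid A)) {i : Fin n}
    {l' : List (Fin n)} (hl' : IsReducedWord A l') {l : List (Fin n)} (hi : i ∉ l)
    (h : reflWord A l' = reflWord A l) : i ∉ l' := by
  obtain ⟨B, hB⟩ := exists_isInvariantForm hdiag hfin
  induction l' using List.reverseRecOn generalizing l with
  | nil => simp
  | append_singleton l' j ih =>
    have hmul : reflWord A l' = reflWord A (l ++ [j]) := by
      rw [reflWord_append, ← h]
      simp [mul_assoc, simpleRefl_mul_self hdiag]
    have hij : i ≠ j := by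
      rintro rfl
      obtain ⟨l'', hlen, hl''⟩ := hB.exists_shorter_word hdiag hoff l' i ⟨i, by
        rw [hmul, reflWord_append, Module.End.mul_apply, reflWord_apply_of_notMem hi,
          reflWord_cons, reflWord_nil, mul_one, simpleRefl_simpleRoot hdiag]
        simp [simpleRoot]⟩
      have := isReducedWord_iff.mp hl' l'' hl''
      simp at this
      omega
    have := ih hl'.of_append (l := l ++ [j]) (by simp [hi, hij]) hmul
    simp [this, hij]

theorem suppW_reflWord (hdiag : ∀ i, A i i = 2) (hoff : ∀ i j, i ≠ j → A i j ≤ 0)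
    (hfin : Finite (weylMonoid A)) {l : List (Fin n)} (hl : IsReducedWord A l) :
    suppW A (reflWord A l) = {i | i ∈ l} := by
  ext i
  constructor
  · rintro ⟨l', hl', h, hi⟩
    by_contra hil
    exact hl'.notMem_of_reflWord_eq hdiag hoff hfin hil h hi
  · exact fun hi => ⟨l, hl, rfl, hi⟩

end ReducedWords

section JointKernel

variable {n : ℕ} {A : Matrix (Fin n) (Fin n) ℤ} {M : Type*} [AddCommGroup M]

theorem map_reflWord_of_betas (f : RootLattice n →+ M) (l : List (Fin n))
    (hf : ∀ l₁ i l₂, l = l₁ ++ i :: l₂ → f (reflWord A l₁ (simpleRoot i)) = 0)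
    (x : RootLattice n) : f (reflWord A l x) = f x := by
  induction l using List.reverseRecOn generalizing x with
  | nil => simp
  | append_singleton l j ih =>
    have hl := ih fun l₁ i l₂ h => hf l₁ i (l₂ ++ [j]) (by simp [h])
    have hj := (hl _).symm.trans (hf l j [] rfl)
    simp [-zsmul_eq_mul, simpleRefl_apply, hl, hj]

theorem map_reflWord_of_simpleRoots (f : RootLattice n →+ M) (l : List (Fin n))
    (hf : ∀ i ∈ l, f (simpleRoot i) = 0) (x : RootLattice n) : f (reflWord A l x) = f x := by
  induction l with
  | nil => simp
  | cons j l ih =>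
    simp only [List.mem_cons, forall_eq_or_imp] at hf
    simp [-zsmul_eq_mul, simpleRefl_apply, ih hf.2, hf.1]

/-- The roots `β_j` of a word and the simple roots of its letters are killed by the same
homomorphisms. -/
theorem map_betas_eq_zero_iff (f : RootLattice n →+ M) (l : List (Fin n)) :
    (∀ j : Fin l.length, f (reflWord A (l.take j) (simpleRoot (l.get j))) = 0) ↔
      ∀ i ∈ l, f (simpleRoot i) = 0 := by
  constructor
  · intro h i hi
    have h' : ∀ l₁ i l₂, l = l₁ ++ i :: l₂ → f (reflWord A l₁ (simpleRoot i)) = 0 := by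
      rintro l₁ i l₂ rfl
      simpa using h ⟨l₁.length, by simp⟩
    obtain ⟨l₁, l₂, rfl⟩ := List.append_of_mem hi
    rw [← map_reflWord_of_betas (A := A) f l₁ (fun l₃ j l₄ hj =>
      h' l₃ j (l₄ ++ i :: l₂) (by simp [hj]))]
    exact h' l₁ i l₂ rfl
  · intro h j
    rw [map_reflWord_of_simpleRoots f _ fun i hi => h i (List.mem_of_mem_take hi)]
    exact h _ (List.get_mem l j)

theorem mem_jointKernel_betas {k : Type*} [Field k] {l : List (Fin n)}
    {φ : Multiplicative (RootLattice n) →* kˣ} :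
    φ ∈ jointKernel k {x : RootLattice n |
        ∃ j : Fin l.length, x = reflWord A (l.take j) (simpleRoot (l.get j))} ↔
      ∀ i ∈ l, φ (Multiplicative.ofAdd (simpleRoot i)) = 1 := by
  refine Iff.trans ?_ (map_betas_eq_zero_iff (A := A) (MonoidHom.toAdditiveRight φ) l)
  constructor
  · exact fun h j => h _ ⟨j, rfl⟩
  · rintro h _ ⟨j, rfl⟩
    exact h j

theorem apply_eq_prod_simpleRoot {G : Type*} [CommGroup G]
    (φ : Multiplicative (RootLattice n) →* G) (x : RootLattice n) :
    φ (Multiplicative.ofAdd x) = ∏ i, φ (Multiplicative.ofAdd (simpleRoot i)) ^ x i := by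
  conv_lhs => rw [← sum_smul_simpleRoot x, ofAdd_sum, map_prod]
  simp [-zsmul_eq_mul, ofAdd_zsmul]

/-- The homomorphism on the root lattice with prescribed values on simple roots. -/
def homOfSimpleRoots {G : Type*} [CommGroup G] (g : Fin n → G) :
    Multiplicative (RootLattice n) →* G where
  toFun x := ∏ i, g i ^ x.toAdd i
  map_one' := by simp
  map_mul' x y := by simp [zpow_add, Finset.prod_mul_distrib]

theorem homOfSimpleRoots_simpleRoot {G : Type*} [CommGroup G] (g : Fin n → G) (i : Fin n) :
    homOfSimpleRoots g (Multiplicative.ofAdd (simpleRoot i)) = g i := by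
  change ∏ j, g j ^ (simpleRoot i : RootLattice n) j = g i
  rw [Finset.prod_eq_single i] <;> simp +contextual [simpleRoot]

/-- Homomorphisms killing the roots `β_j` of a word are determined freely by their values on the
simple roots outside of the word. -/
theorem nonempty_jointKernel_betas_mulEquiv {k : Type*} [Field k] (l : List (Fin n)) :
    Nonempty (jointKernel k {x : RootLattice n |
        ∃ j : Fin l.length, x = reflWord A (l.take j) (simpleRoot (l.get j))} ≃*
      ({i // i ∉ l} → kˣ)) := by
  let restrict : jointKernel k {x : RootLattice n |
      ∃ j : Fin l.length, x = reflWord A (l.take j) (simpleRoot (l.get j))} →*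
      ({i // i ∉ l} → kˣ) :=
    { toFun := fun φ i => φ.1 (Multiplicative.ofAdd (simpleRoot i.1))
      map_one' := rfl
      map_mul' := fun _ _ => rfl }
  refine ⟨MulEquiv.ofBijective restrict ⟨?_, ?_⟩⟩
  · intro φ ψ h
    have hφ := mem_jointKernel_betas.mp φ.2
    have hψ := mem_jointKernel_betas.mp ψ.2
    refine Subtype.ext (MonoidHom.ext fun x => ?_)
    have key := fun χ : Multiplicative (RootLattice n) →* kˣ =>
      apply_eq_prod_simpleRoot χ x.toAdd
    rw [ofAdd_toAdd] at key
    rw [key, key]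
    refine Finset.prod_congr rfl fun i _ => ?_
    by_cases hi : i ∈ l
    · rw [hφ i hi, hψ i hi]
    · exact congrArg (· ^ _) (congrFun h ⟨i, hi⟩)
  · intro g
    refine ⟨⟨homOfSimpleRoots fun i => if h : i ∈ l then 1 else g ⟨i, h⟩,
      mem_jointKernel_betas.mpr fun i hi => ?_⟩, funext fun i => ?_⟩
    · rw [homOfSimpleRoots_simpleRoot, dif_pos hi]
    · exact (homOfSimpleRoots_simpleRoot _ _).trans (dif_neg i.2)

end JointKernel

theorem joint_kernel_of_betas_iso_torus
    {n : ℕ} (k : Type*) [Field k] (A : Matrix (Fin n) (Fin n) ℤ)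
    -- `A` is a crystallographic Cartan matrix:
    (hdiag : ∀ i, A i i = 2)
    (hoff : ∀ i j, i ≠ j → A i j ≤ 0)
    (hzero : ∀ i j, A i j = 0 → A j i = 0)
    -- the root system is finite, i.e. the Weyl group is finite:
    (hfin : Finite (weylMonoid A))
    -- a reduced expression `w = s_{i_1} ⋯ s_{i_r}`:
    (l : List (Fin n)) (hred : IsReducedWord A l)
    (w : Module.End ℤ (RootLattice n)) (hw : reflWord A l = w)
    -- the support of `w` consists of exactly `m` distinct simple reflections:
    (m : ℕ) (hm : (suppW A w).ncard = m) :
    Nonempty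
      ((jointKernel k
          {x : RootLattice n |
            ∃ j : Fin l.length, x = reflWord A (l.take j) (simpleRoot (l.get j))}) ≃*
        (Fin (n - m) → kˣ)) := by
  subst hw
  obtain ⟨e⟩ := nonempty_jointKernel_betas_mulEquiv (A := A) (k := k) l
  rw [suppW_reflWord hdiag hoff hfin hred] at hm
  have hcard : Fintype.card {i // i ∉ l} = n - m := by
    rw [Fintype.card_subtype_compl, Fintype.card_fin, ← hm, ← Nat.card_coe_set_eq,
      ← Nat.card_eq_fintype_card]
    rfl
  exact ⟨e.trans (MulEquiv.arrowCongr (Fintype.equivFinOfCardEq hcard) (MulEquiv.refl _))⟩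
end
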